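/- Let T ≠ 0 and C be real numbers and f, f₁ : ℝ → ℝ smooth functions. On ℝ³ with coordinates (u,w,x), define a(u,w,x) = (1 − e^{4Tw})/(2T) + (2T² − C)x² − 2x f(u) + f₁(u), the smooth 1-forms ω⁰ = e^{2Tw} du, ω¹ = 2 dw + 4Tx du, ω² = e^{−2Tw}(dx + a du), and the smooth function ε = e^{−2Tw}(C x + f(u)). Then: (i) at every point the three covectors ω⁰, ω¹, ω² are linearly independent; (ii) dω⁰ = −T ω⁰∧ω¹; (iii) dω¹ = −4T ω⁰∧ω²; (iv) dω² = ω⁰∧ω¹ + 2ε ω⁰∧ω² − T ω¹∧ω²; and (v) there exists a smooth function P : ℝ³ → ℝ such that dε = P ω⁰ − Tε ω¹ + C ω². -/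

import Mathlib

open Real

/-- Points of `ℝ³`, with coordinates `(u, w, x) = (p 0, p 1, p 2)`. -/
abbrev Pt : Type := Fin 3 → ℝ

/-- A 1-form on `ℝ³`: a field of continuous linear functionals. -/
abbrev OneForm : Type := Pt → (Pt →L[ℝ] ℝ)

/-- The exterior derivative of a 1-form, via the Fréchet derivative:
`dω_p(X,Y) = (Dω_p X)(Y) − (Dω_p Y)(X)`. -/
noncomputable def extd (ω : OneForm) (p : Pt) (X Y : Pt) : ℝ :=
  fderiv ℝ ω p X Y - fderiv ℝ ω p Y X

/-- The wedge of two 1-forms: `(ω∧σ)_p(X,Y) = ω_p(X)σ_p(Y) − ω_p(Y)σ_p(X)`. -/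
def wedge (ω σ : OneForm) (p : Pt) (X Y : Pt) : ℝ :=
  ω p X * σ p Y - ω p Y * σ p X

/-- The constant coordinate 1-forms `du, dw, dx`. -/
noncomputable def pr (i : Fin 3) : Pt →L[ℝ] ℝ := ContinuousLinearMap.proj i

/-- The metric function `a = (1 − e^{4Tw})/(2T) + (2T² − C)x² − 2x f(u) + f₁(u)`. -/
noncomputable def aFun (T C : ℝ) (f f₁ : ℝ → ℝ) (p : Pt) : ℝ :=
  (1 - exp (4 * T * p 1)) / (2 * T) + (2 * T ^ 2 - C) * (p 2) ^ 2
    - 2 * (p 2) * f (p 0) + f₁ (p 0)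

/-- The coframe `ω⁰ = e^{2Tw} du`. -/
noncomputable def ω₀ (T : ℝ) : OneForm := fun p => exp (2 * T * p 1) • pr 0

/-- The coframe `ω¹ = 2 dw + 4Tx du`. -/
noncomputable def ω₁ (T : ℝ) : OneForm := fun p => (2 : ℝ) • pr 1 + (4 * T * p 2) • pr 0

/-- The coframe `ω² = e^{−2Tw}(dx + a du)`. -/
noncomputable def ω₂ (T C : ℝ) (f f₁ : ℝ → ℝ) : OneForm :=
  fun p => exp (-(2 * T * p 1)) • (pr 2 + aFun T C f f₁ p • pr 0)

/-- The invariant `ε = e^{−2Tw}(Cx + f(u))`. -/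
noncomputable def εFun (T C : ℝ) (f : ℝ → ℝ) (p : Pt) : ℝ :=
  exp (-(2 * T * p 1)) * (C * p 2 + f (p 0))

theorem pr_apply (i : Fin 3) (X : Pt) : pr i X = X i := rfl

theorem hasFDerivAt_coord (i : Fin 3) (p : Pt) : HasFDerivAt (fun q : Pt => q i) (pr i) p :=
  (pr i).hasFDerivAt

theorem hasFDerivAt_exp_const_mul_coord (c : ℝ) (i : Fin 3) (p : Pt) :
    HasFDerivAt (fun q : Pt => exp (c * q i)) ((c * exp (c * p i)) • pr i) p := by
  have h := ((hasFDerivAt_coord i p).const_mul c).exp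
  rwa [smul_smul, mul_comm] at h

theorem hasFDerivAt_exp_neg_const_mul_coord (c : ℝ) (i : Fin 3) (p : Pt) :
    HasFDerivAt (fun q : Pt => exp (-(c * q i))) ((-c * exp (-(c * p i))) • pr i) p := by
  simpa only [neg_mul] using hasFDerivAt_exp_const_mul_coord (-c) i p

theorem hasFDerivAt_comp_coord {f : ℝ → ℝ} (hf : Differentiable ℝ f) (i : Fin 3) (p : Pt) :
    HasFDerivAt (fun q : Pt => f (q i)) (deriv f (p i) • pr i) p :=
  (hf (p i)).hasDerivAt.comp_hasFDerivAt p (hasFDerivAt_coord i p)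

/-- The Leibniz rule `d(g ω) = g dω + dg ∧ ω`. -/
theorem extd_smul {g : Pt → ℝ} {g' : Pt →L[ℝ] ℝ} {ω : OneForm} {ω' : Pt →L[ℝ] (Pt →L[ℝ] ℝ)}
    {p : Pt} (hg : HasFDerivAt g g' p) (hω : HasFDerivAt ω ω' p) (X Y : Pt) :
    extd (fun q => g q • ω q) p X Y =
      g p * (ω' X Y - ω' Y X) + (g' X * ω p Y - g' Y * ω p X) := by
  simp only [extd, (hg.fun_smul hω).fderiv, add_apply,
    smul_apply, ContinuousLinearMap.smulRight_apply, smul_eq_mul]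
  ring

theorem hasFDerivAt_add_smul {g : Pt → ℝ} {g' : Pt →L[ℝ] ℝ} {p : Pt} (L M : Pt →L[ℝ] ℝ)
    (hg : HasFDerivAt g g' p) :
    HasFDerivAt (fun q => L + g q • M) (g'.smulRight M) p :=
  (hg.smul_const M).const_add L

theorem hasFDerivAt_aFun {T : ℝ} (hT : T ≠ 0) (C : ℝ) {f f₁ : ℝ → ℝ}
    (hf : Differentiable ℝ f) (hf₁ : Differentiable ℝ f₁) (p : Pt) :
    HasFDerivAt (aFun T C f f₁)
      ((deriv f₁ (p 0) - 2 * p 2 * deriv f (p 0)) • pr 0 + (-2 * exp (4 * T * p 1)) • pr 1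
        + (2 * (2 * T ^ 2 - C) * p 2 - 2 * f (p 0)) • pr 2) p := by
  have hx := hasFDerivAt_coord 2 p
  have h := ((((hasFDerivAt_exp_const_mul_coord (4 * T) 1 p).const_sub 1).mul_const
    (2 * T)⁻¹).add ((hx.pow 2).const_mul (2 * T ^ 2 - C))).sub
      ((hx.const_mul 2).mul (hasFDerivAt_comp_coord hf 0 p)) |>.add
      (hasFDerivAt_comp_coord hf₁ 0 p)
  refine HasFDerivAt.congr_fderiv h ?_
  ext X
  simp [pr_apply]
  field_simp
  ring

theorem hasFDerivAt_εFun (T C : ℝ) {f : ℝ → ℝ} (hf : Differentiable ℝ f) (p : Pt) :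
    HasFDerivAt (εFun T C f)
      (exp (-(2 * T * p 1)) • (deriv f (p 0) • pr 0 + C • pr 2)
        - (2 * T * εFun T C f p) • pr 1) p := by
  have h := (hasFDerivAt_exp_neg_const_mul_coord (2 * T) 1 p).mul
    (((hasFDerivAt_coord 2 p).const_mul C).add (hasFDerivAt_comp_coord hf 0 p))
  refine HasFDerivAt.congr_fderiv h ?_
  ext X
  simp [pr_apply, εFun]
  ring

theorem linearIndependent_coframe (T C : ℝ) (f f₁ : ℝ → ℝ) (p : Pt) :
    LinearIndependent ℝ ![ω₀ T p, ω₁ T p, ω₂ T C f f₁ p] := by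
  rw [Fintype.linearIndependent_iff]
  intro c hc
  have h (X : Pt) := DFunLike.congr_fun hc X
  have h2 : c 2 = 0 := by
    simpa [Fin.sum_univ_three, ω₀, ω₁, ω₂, pr_apply, exp_ne_zero] using h (Pi.single 2 1)
  have h1 : c 1 = 0 := by
    simpa [Fin.sum_univ_three, ω₀, ω₁, ω₂, pr_apply, exp_ne_zero, h2] using h (Pi.single 1 1)
  have h0 : c 0 = 0 := by
    simpa [Fin.sum_univ_three, ω₀, ω₁, ω₂, pr_apply, exp_ne_zero, h1, h2] using
      h (Pi.single 0 1)
  intro i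
  fin_cases i
  exacts [h0, h1, h2]

theorem extd_ω₀ (T : ℝ) (p X Y : Pt) :
    extd (ω₀ T) p X Y = -T * wedge (ω₀ T) (ω₁ T) p X Y := by
  unfold ω₀
  rw [extd_smul (hasFDerivAt_exp_const_mul_coord (2 * T) 1 p) (hasFDerivAt_const (pr 0) p)]
  simp [wedge, ω₁, pr_apply]
  ring

theorem extd_ω₁ (T C : ℝ) (f f₁ : ℝ → ℝ) (p X Y : Pt) :
    extd (ω₁ T) p X Y = -(4 * T) * wedge (ω₀ T) (ω₂ T C f f₁) p X Y := by
  have h : HasFDerivAt (ω₁ T) (((4 * T) • pr 2).smulRight (pr 0)) p :=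
    hasFDerivAt_add_smul _ _ ((hasFDerivAt_coord 2 p).const_mul (4 * T))
  simp [extd, h.fderiv, wedge, ω₀, ω₂, pr_apply, exp_neg]
  field_simp
  ring

theorem extd_ω₂ {T : ℝ} (hT : T ≠ 0) (C : ℝ) {f f₁ : ℝ → ℝ}
    (hf : Differentiable ℝ f) (hf₁ : Differentiable ℝ f₁) (p X Y : Pt) :
    extd (ω₂ T C f f₁) p X Y =
      wedge (ω₀ T) (ω₁ T) p X Y
        + 2 * εFun T C f p * wedge (ω₀ T) (ω₂ T C f f₁) p X Y
        - T * wedge (ω₁ T) (ω₂ T C f f₁) p X Y := by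
  have hexp : exp (4 * T * p 1) = exp (2 * T * p 1) ^ 2 := by
    rw [← exp_nat_mul]
    congr 1
    push_cast
    ring
  unfold ω₂
  rw [extd_smul (hasFDerivAt_exp_neg_const_mul_coord (2 * T) 1 p)
    (hasFDerivAt_add_smul (pr 2) (pr 0) (hasFDerivAt_aFun hT C hf hf₁ p))]
  simp [wedge, ω₀, ω₁, εFun, pr_apply, exp_neg, hexp]
  field_simp
  ring

theorem exists_fderiv_εFun_eq (T C : ℝ) {f f₁ : ℝ → ℝ}
    (hf : ContDiff ℝ (⊤ : ℕ∞) f) (hf₁ : ContDiff ℝ (⊤ : ℕ∞) f₁) :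
    ∃ P : Pt → ℝ, ContDiff ℝ (⊤ : ℕ∞) P ∧
      ∀ p : Pt, fderiv ℝ (εFun T C f) p =
        P p • ω₀ T p - (T * εFun T C f p) • ω₁ T p + C • ω₂ T C f f₁ p := by
  refine ⟨fun p => exp (-(2 * T * p 1)) * (exp (-(2 * T * p 1)) * deriv f (p 0)
    + 4 * T ^ 2 * p 2 * εFun T C f p - C * exp (-(2 * T * p 1)) * aFun T C f f₁ p), ?_, ?_⟩
  · have hf' : ContDiff ℝ (⊤ : ℕ∞) (deriv f) := (contDiff_infty_iff_deriv.mp hf).2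
    unfold εFun aFun
    fun_prop
  · intro p
    rw [(hasFDerivAt_εFun T C (hf.differentiable (by simp)) p).fderiv]
    ext X
    simp [ω₀, ω₁, ω₂, pr_apply, exp_neg]
    field_simp
    ring

/-- The explicit coframe underlying the maximal-order metric of the main theorem is a
pointwise-independent coframe solving the type D, properly CH₁ structure equations. -/
theorem explicit_coframe_solves_structure_equations
    (T C : ℝ) (hT : T ≠ 0) (f f₁ : ℝ → ℝ)
    (hf : ContDiff ℝ (⊤ : ℕ∞) f) (hf₁ : ContDiff ℝ (⊤ : ℕ∞) f₁) :
    (∀ p : Pt, LinearIndependent ℝ ![ω₀ T p, ω₁ T p, ω₂ T C f f₁ p]) ∧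
    (∀ p X Y, extd (ω₀ T) p X Y = -T * wedge (ω₀ T) (ω₁ T) p X Y) ∧
    (∀ p X Y, extd (ω₁ T) p X Y = -(4 * T) * wedge (ω₀ T) (ω₂ T C f f₁) p X Y) ∧
    (∀ p X Y, extd (ω₂ T C f f₁) p X Y =
        wedge (ω₀ T) (ω₁ T) p X Y
          + 2 * εFun T C f p * wedge (ω₀ T) (ω₂ T C f f₁) p X Y
          - T * wedge (ω₁ T) (ω₂ T C f f₁) p X Y) ∧
    (∃ P : Pt → ℝ, ContDiff ℝ (⊤ : ℕ∞) P ∧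
      ∀ p : Pt, fderiv ℝ (εFun T C f) p =
        P p • ω₀ T p - (T * εFun T C f p) • ω₁ T p + C • ω₂ T C f f₁ p) := by
  have hfd : Differentiable ℝ f := hf.differentiable (by simp)
  have hfd₁ : Differentiable ℝ f₁ := hf₁.differentiable (by simp)
  exact ⟨linearIndependent_coframe T C f f₁, extd_ω₀ T, extd_ω₁ T C f f₁,
    extd_ω₂ hT C hfd hfd₁, exists_fderiv_εFun_eq T C hf hf₁⟩
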